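/- arXiv:1409.5540 — 3 statements merged into one kernel-verified Lean document; each statement's English description precedes it below -/
import Mathlib

section
/- Let p>1, let a>0 be a constant, and let W satisfy (W1) and (W2). If v is a solution of the autonomous equation -(φ_p(v'))'+aW'(v)=0 whose energy H_a(v,v')=-(1/a)L(v')+W(v) is identically equal to 0, then v is defined on all of ℝ and ∫_{-∞}^{+∞} L(v'(x)) dx < +∞. -/
open Real Set Filter Topology MeasureTheory intervalIntegral Asymptotics

noncomputable section

/-- `φ_p(s) = |s|^{p-2} s`. -/
def phip (p s : ℝ) : ℝ := |s| ^ (p - 2) * s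

/-- `L(s) = |s|^p / p*` with `p* = p/(p-1)`. -/
def Lfun (p s : ℝ) : ℝ := |s| ^ p / (p / (p - 1))

/-- condition (W1) -/
def W1cond (p : ℝ) (W : ℝ → ℝ) (Cm1 C0 C1 W0 : ℝ) : Prop :=
  0 < Cm1 ∧ 0 < C0 ∧ 0 < C1 ∧ 0 < W0 ∧
  (fun u => W u - C1 / p * |u - 1| ^ p) =o[𝓝[Set.Icc (-1:ℝ) 1] 1] (fun u => |u - 1| ^ p) ∧
  (fun u => W u - Cm1 / p * |u + 1| ^ p) =o[𝓝[Set.Icc (-1:ℝ) 1] (-1)] (fun u => |u + 1| ^ p) ∧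
  (fun u => W u - (W0 - C0 / p * |u| ^ p)) =o[𝓝[Set.Icc (-1:ℝ) 1] 0] (fun u => |u| ^ p)

/-- condition (W2) -/
def W2cond (p : ℝ) (W : ℝ → ℝ) : Prop :=
  StrictAntiOn (fun u => deriv W u / phip p u) (Set.Ico (-1:ℝ) 0) ∧
  StrictMonoOn (fun u => deriv W u / phip p u) (Set.Ioc (0:ℝ) 1)

/-- `v` (with derivative `v'`) is a global solution of `-(φ_p(v'))' + a W'(v) = 0`. -/
def IsSolAuto (p aa : ℝ) (W v v' : ℝ → ℝ) : Prop :=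
  Continuous v' ∧ (∀ x, HasDerivAt v (v' x) x) ∧
  ∃ g : ℝ → ℝ, Continuous g ∧ (∀ x, HasDerivAt (fun y => phip p (v' y)) (g x) x) ∧
    ∀ x, g x = aa * deriv W (v x)

/-- `v` (with derivative `v'`) solves `-(φ_p(v'))' + a W'(v) = 0` on the open set `I`. -/
def IsSolAutoOn (p aa : ℝ) (W v v' : ℝ → ℝ) (I : Set ℝ) : Prop :=
  ContinuousOn v' I ∧ (∀ x ∈ I, HasDerivAt v (v' x) x) ∧
  ∃ g : ℝ → ℝ, ContinuousOn g I ∧ (∀ x ∈ I, HasDerivAt (fun y => phip p (v' y)) (g x) x) ∧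
    ∀ x ∈ I, g x = aa * deriv W (v x)

/-- `u` (with derivative `u'`) solves `-ε(φ_p(εu'))' + a(x) W'(u) = 0` on `S`. -/
def IsSolOn (p ε : ℝ) (a W u u' : ℝ → ℝ) (S : Set ℝ) : Prop :=
  ContinuousOn u' S ∧ (∀ x ∈ S, HasDerivWithinAt u (u' x) S x) ∧
  ∃ g : ℝ → ℝ, ContinuousOn g S ∧
    (∀ x ∈ S, HasDerivWithinAt (fun y => phip p (ε * u' y)) (g x) S x) ∧
    ∀ x ∈ S, ε * g x = a x * deriv W (u x)

/-- `u` is a solution of the Neumann problem `(P_ε)`. -/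
def IsNeumann (p ε : ℝ) (a W u u' : ℝ → ℝ) : Prop :=
  IsSolOn p ε a W u u' (Set.Icc 0 1) ∧ u' 0 = 0 ∧ u' 1 = 0

/-- energy of a solution of `(P_ε)` -/
def Ener (p ε : ℝ) (a W u u' : ℝ → ℝ) (x : ℝ) : ℝ :=
  -(1 / a x) * Lfun p (ε * u' x) + W (u x)

/-- `π_p` -/
def pip (p : ℝ) : ℝ := 2 * (p - 1) ^ (1 / p) * ∫ s in (0:ℝ)..1, ((1:ℝ) - s ^ p) ^ (-(1 / p))

/-- A function on an open interval whose derivative is dominated by a multiple of the function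
vanishes identically as soon as it vanishes at one point. -/
theorem eqOn_zero_of_abs_deriv_le {I : Set ℝ} (hI : IsPreconnected I) {f f' : ℝ → ℝ} {K x₀ : ℝ}
    (hf : ∀ x ∈ I, HasDerivAt f (f' x) x) (hbound : ∀ x ∈ I, |f' x| ≤ K * |f x|)
    (hx₀ : x₀ ∈ I) (h0 : f x₀ = 0) : ∀ x ∈ I, f x = 0 := by
  intro x hx
  have hord := hI.ordConnected
  rcases le_total x₀ x with hle | hle
  · have hsub : Icc x₀ x ⊆ I := hord.out hx₀ hx
    exact eq_zero_of_abs_deriv_le_mul_abs_self_of_eq_zero_right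
      (fun y hy => (hf y (hsub hy)).continuousAt.continuousWithinAt)
      (fun y hy => (hf y (hsub (Ico_subset_Icc_self hy))).hasDerivWithinAt) h0
      (fun y hy => hbound y (hsub (Ico_subset_Icc_self hy))) x ⟨hle, le_rfl⟩
  · have hsub : ∀ y ∈ Icc (-x₀) (-x), -y ∈ I := fun y hy =>
      hord.out hx hx₀ ⟨by linarith [hy.2], by linarith [hy.1]⟩
    have hder : ∀ y ∈ Icc (-x₀) (-x), HasDerivAt (fun z => f (-z)) (-f' (-y)) y := fun y hy => by
      simpa [Function.comp_def] using (hf (-y) (hsub y hy)).comp y (hasDerivAt_neg y)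
    have := eq_zero_of_abs_deriv_le_mul_abs_self_of_eq_zero_right
      (f := fun z => f (-z)) (f' := fun y => -f' (-y)) (K := K)
      (fun y hy => (hder y hy).continuousAt.continuousWithinAt)
      (fun y hy => (hder y (Ico_subset_Icc_self hy)).hasDerivWithinAt) (by simpa using h0)
      (fun y hy => by simpa using hbound (-y) (hsub y (Ico_subset_Icc_self hy)))
      (-x) ⟨by linarith, le_rfl⟩
    simpa using this

/-- Solution of `U' = F(U)` by separation of variables: if `F` is positive on `(-1, 1)` and decays
at most linearly at `±1`, the time map `G` is a bijection onto `ℝ` with inverse `U`. -/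
theorem exists_time_map_and_inverse {F : ℝ → ℝ} {K : ℝ} (hK : 0 < K)
    (hF : ContinuousOn F (Ioo (-1) 1)) (hpos : ∀ u ∈ Ioo (-1 : ℝ) 1, 0 < F u)
    (hle₁ : ∀ u ∈ Ioo (-1 : ℝ) 1, F u ≤ K * (1 - u))
    (hle₂ : ∀ u ∈ Ioo (-1 : ℝ) 1, F u ≤ K * (1 + u)) :
    ∃ G U : ℝ → ℝ, (∀ u ∈ Ioo (-1 : ℝ) 1, HasDerivAt G (F u)⁻¹ u) ∧
      (∀ x, U x ∈ Ioo (-1 : ℝ) 1) ∧ (∀ x, HasDerivAt U (F (U x)) x) ∧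
      ∀ u ∈ Ioo (-1 : ℝ) 1, U (G u) = u := by
  have h0 : (0 : ℝ) ∈ Ioo (-1 : ℝ) 1 := by constructor <;> norm_num
  have hinv : ContinuousOn (fun u => (F u)⁻¹) (Ioo (-1) 1) :=
    hF.inv₀ fun u hu => (hpos u hu).ne'
  let G : ℝ → ℝ := fun u => ∫ s in (0 : ℝ)..u, (F s)⁻¹
  have hG0 : G 0 = 0 := intervalIntegral.integral_same
  have hG : ∀ u ∈ Ioo (-1 : ℝ) 1, HasDerivAt G (F u)⁻¹ u := fun u hu =>
    intervalIntegral.integral_hasDerivAt_right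
      ((hinv.mono (ordConnected_Ioo.uIcc_subset h0 hu)).intervalIntegrable)
      (hinv.stronglyMeasurableAtFilter isOpen_Ioo u hu)
      (hinv.continuousAt (isOpen_Ioo.mem_nhds hu))
  have hGcont : ContinuousOn G (Ioo (-1) 1) := fun u hu => (hG u hu).continuousAt.continuousWithinAt
  have hmono : StrictMonoOn G (Ioo (-1) 1) := by
    refine strictMonoOn_of_deriv_pos (convex_Ioo _ _) hGcont fun u hu => ?_
    rw [interior_Ioo] at hu
    rw [(hG u hu).deriv]
    exact inv_pos.2 (hpos u hu)
  have hlower : MonotoneOn (fun u => G u + K⁻¹ * log (1 - u)) (Ioo (-1) 1) := by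
    have hd : ∀ u ∈ Ioo (-1 : ℝ) 1,
        HasDerivAt (fun u => G u + K⁻¹ * log (1 - u)) ((F u)⁻¹ + K⁻¹ * (-1 / (1 - u))) u :=
      fun u hu => (hG u hu).add
        ((((hasDerivAt_id u).const_sub 1).log (by simp only [id]; linarith [hu.2])).const_mul K⁻¹)
    refine monotoneOn_of_deriv_nonneg (convex_Ioo _ _)
      (fun u hu => (hd u hu).continuousAt.continuousWithinAt)
      (fun u hu => ?_) fun u hu => ?_
    · rw [interior_Ioo] at hu
      exact (hd u hu).differentiableAt.differentiableWithinAt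
    · rw [interior_Ioo] at hu
      rw [(hd u hu).deriv]
      have := inv_anti₀ (hpos u hu) (hle₁ u hu)
      rw [mul_inv] at this
      rw [neg_div, one_div]
      linarith
  have hupper : MonotoneOn (fun u => G u - K⁻¹ * log (1 + u)) (Ioo (-1) 1) := by
    have hd : ∀ u ∈ Ioo (-1 : ℝ) 1,
        HasDerivAt (fun u => G u - K⁻¹ * log (1 + u)) ((F u)⁻¹ - K⁻¹ * (1 / (1 + u))) u :=
      fun u hu => (hG u hu).sub
        ((((hasDerivAt_id u).const_add 1).log (by simp only [id]; linarith [hu.1])).const_mul K⁻¹)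
    refine monotoneOn_of_deriv_nonneg (convex_Ioo _ _)
      (fun u hu => (hd u hu).continuousAt.continuousWithinAt)
      (fun u hu => ?_) fun u hu => ?_
    · rw [interior_Ioo] at hu
      exact (hd u hu).differentiableAt.differentiableWithinAt
    · rw [interior_Ioo] at hu
      rw [(hd u hu).deriv]
      have := inv_anti₀ (hpos u hu) (hle₂ u hu)
      rw [mul_inv] at this
      rw [one_div]
      linarith
  have htop : Tendsto G (𝓝[<] 1) atTop := by
    have hlog : Tendsto (fun u : ℝ => log (1 - u)) (𝓝[<] 1) atBot := by
      refine tendsto_log_nhdsGT_zero.comp (tendsto_nhdsWithin_iff.2 ⟨?_, ?_⟩)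
      · refine Tendsto.mono_left ?_ nhdsWithin_le_nhds
        exact (by fun_prop : Continuous fun u : ℝ => 1 - u).tendsto' 1 0 (by norm_num)
      · filter_upwards [self_mem_nhdsWithin] with u hu
        exact show 0 < 1 - u from sub_pos.2 hu
    refine tendsto_atTop_mono' _ ?_ (hlog.const_mul_atBot_of_neg (neg_lt_zero.2 (inv_pos.2 hK)))
    filter_upwards [Ioo_mem_nhdsLT (zero_lt_one : (0 : ℝ) < 1)] with u hu
    have := hlower h0 ⟨by linarith [hu.1], hu.2⟩ hu.1.le
    simp only [hG0, sub_zero, log_one] at this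
    linarith
  have hbot : Tendsto G (𝓝[>] (-1)) atBot := by
    have hlog : Tendsto (fun u : ℝ => log (1 + u)) (𝓝[>] (-1)) atBot := by
      refine tendsto_log_nhdsGT_zero.comp (tendsto_nhdsWithin_iff.2 ⟨?_, ?_⟩)
      · refine Tendsto.mono_left ?_ nhdsWithin_le_nhds
        exact (by fun_prop : Continuous fun u : ℝ => 1 + u).tendsto' (-1) 0 (by norm_num)
      · filter_upwards [self_mem_nhdsWithin] with u hu
        have : -1 < u := hu
        exact show 0 < 1 + u by linarith
    refine tendsto_atBot_mono' _ ?_ (hlog.const_mul_atBot (inv_pos.2 hK))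
    filter_upwards [Ioo_mem_nhdsGT (by norm_num : (-1 : ℝ) < 0)] with u hu
    have := hupper ⟨hu.1, by linarith [hu.2]⟩ h0 hu.2.le
    simp only [hG0, add_zero, log_one] at this
    linarith
  have hlt : (-1 : ℝ) < 1 := by norm_num
  have hsurj : SurjOn G (Ioo (-1) 1) univ :=
    hGcont.surjOn_of_tendsto ⟨0, h0⟩ (by rwa [tendsto_comp_coe_Ioo_atBot hlt])
      (by rwa [tendsto_comp_coe_Ioo_atTop hlt])
  let e : Ioo (-1 : ℝ) 1 ≃o ℝ := StrictMono.orderIsoOfSurjective (fun u => G u)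
    (fun u w h => hmono u.2 w.2 h) fun y => by
      obtain ⟨u, hu, huy⟩ := hsurj (mem_univ y)
      exact ⟨⟨u, hu⟩, huy⟩
  have hGU : ∀ x, G (e.symm x) = x := fun x => e.apply_symm_apply x
  refine ⟨G, fun x => e.symm x, hG, fun x => (e.symm x).2, fun x => ?_, fun u hu => ?_⟩
  · have := HasDerivAt.of_local_left_inverse
      (continuous_subtype_val.comp e.symm.continuous).continuousAt (hG _ (e.symm x).2)
      (inv_ne_zero (hpos _ (e.symm x).2).ne') (Eventually.of_forall hGU)
    simpa [Function.comp_def] using this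
  · exact congrArg Subtype.val (e.symm_apply_apply ⟨u, hu⟩)

/-- The derivative of a bounded nondecreasing function is integrable. -/
theorem integrable_of_hasDerivAt_of_nonneg_of_bounded {f f' : ℝ → ℝ} {m M : ℝ}
    (hf : ∀ x, HasDerivAt f (f' x) x) (hf' : Continuous f') (hnonneg : ∀ x, 0 ≤ f' x)
    (hm : ∀ x, m ≤ f x) (hM : ∀ x, f x ≤ M) : Integrable f' := by
  refine integrable_of_intervalIntegral_norm_bounded (a := fun r : ℝ => -r) (b := fun r => r)
    (l := atTop) (M - m) (fun r => hf'.integrableOn_Ioc)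
    tendsto_neg_atTop_atBot tendsto_id (Eventually.of_forall fun r => ?_)
  simp only [norm_eq_abs, abs_of_nonneg (hnonneg _)]
  rw [intervalIntegral.integral_eq_sub_of_hasDerivAt (fun x _ => hf x)
    (hf'.intervalIntegrable _ _)]
  linarith [hm (-r), hM r]

/-- Consequences of (W1) and (W2) at the well `u = 1`. -/
theorem potential_right_well {p C : ℝ} {W : ℝ → ℝ} (hp : 1 < p) (hW : ContDiff ℝ 1 W)
    (hasymp : (fun u => W u - C * |u - 1| ^ p) =o[𝓝[Icc (-1 : ℝ) 1] 1] fun u => |u - 1| ^ p)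
    (hmono : StrictMonoOn (fun u => deriv W u / phip p u) (Ioc (0 : ℝ) 1)) :
    W 1 = 0 ∧ deriv W 1 = 0 ∧ (∀ u ∈ Ico (0 : ℝ) 1, 0 < W u) ∧
      ∃ K, ∀ u ∈ Icc (-1 : ℝ) 1, W u ≤ K * (1 - u) ^ p := by
  have hp0 : 0 < p := by linarith
  have h1mem : (1 : ℝ) ∈ Icc (-1 : ℝ) 1 := by constructor <;> norm_num
  have hdiff : Differentiable ℝ W := hW.differentiable one_ne_zero
  have hW1 : W 1 = 0 := by
    have := (hasymp.bound one_pos).self_of_nhdsWithin h1mem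
    simpa [zero_rpow hp0.ne'] using this
  have hbigO : W =O[𝓝[Icc (-1 : ℝ) 1] 1] fun u => |u - 1| ^ p := by
    have := hasymp.isBigO.add ((isBigO_refl (fun u : ℝ => |u - 1| ^ p) _).const_mul_left C)
    simpa using this
  have hlittle : (fun u : ℝ => |u - 1| ^ p) =o[𝓝[Icc (-1 : ℝ) 1] 1] fun u => u - 1 := by
    have hlim : Tendsto (fun u : ℝ => |u - 1| ^ (p - 1)) (𝓝[Icc (-1 : ℝ) 1] 1) (𝓝 0) := by
      have hcont : Continuous fun u : ℝ => |u - 1| ^ (p - 1) :=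
        (continuous_id.sub continuous_const).abs.rpow_const fun _ => Or.inr (by simp; linarith)
      have := hcont.tendsto 1
      simp only [sub_self, abs_zero, zero_rpow (sub_pos.2 hp).ne'] at this
      exact this.mono_left nhdsWithin_le_nhds
    have := ((isLittleO_one_iff ℝ).2 hlim).mul_isBigO
      (isBigO_refl (fun u : ℝ => u - 1) (𝓝[Icc (-1 : ℝ) 1] 1)).abs_left
    refine (this.congr_left fun u => ?_).congr_right fun u => one_mul _
    rcases eq_or_ne u 1 with rfl | hu
    · simp [zero_rpow hp0.ne']
    · rw [← rpow_add_one (abs_ne_zero.2 (sub_ne_zero.2 hu)), sub_add_cancel]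
  have hderiv : deriv W 1 = 0 := by
    have h₁ : HasDerivWithinAt W 0 (Icc (-1) 1) 1 := by
      rw [hasDerivWithinAt_iff_isLittleO]
      simpa [hW1] using hbigO.trans_isLittleO hlittle
    exact (uniqueDiffOn_Icc (by norm_num) 1 h1mem).eq_deriv _ (hdiff 1).hasDerivAt.hasDerivWithinAt h₁
  refine ⟨hW1, hderiv, fun u hu => ?_, ?_⟩
  · have hanti : StrictAntiOn W (Icc 0 1) := by
      refine strictAntiOn_of_deriv_neg (convex_Icc _ _) hdiff.continuous.continuousOn fun x hx => ?_
      rw [interior_Icc] at hx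
      have := hmono ⟨hx.1, hx.2.le⟩ ⟨one_pos, le_rfl⟩ hx.2
      simp only [hderiv, zero_div] at this
      have hφ : 0 < phip p x := mul_pos (rpow_pos_of_pos (abs_pos.2 hx.1.ne') _) hx.1
      exact (div_neg_iff.1 this).resolve_left (fun h => h.2.not_gt hφ) |>.1
    simpa [hW1] using hanti ⟨hu.1, hu.2.le⟩ ⟨zero_le_one, le_rfl⟩ hu.2
  · obtain ⟨c, hc⟩ := hbigO.bound
    obtain ⟨δ, hδ, hball⟩ := Metric.mem_nhdsWithin_iff.1 hc
    obtain ⟨M, hM⟩ := isCompact_Icc.exists_bound_of_continuousOn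
      (hdiff.continuous.continuousOn (s := Icc (-1 : ℝ) 1))
    have hM0 : 0 ≤ M := (norm_nonneg _).trans (hM 1 h1mem)
    refine ⟨max c (M / δ ^ p), fun u hu => ?_⟩
    have hnn : 0 ≤ 1 - u := by linarith [hu.2]
    have habs : |u - 1| = 1 - u := by rw [abs_sub_comm, abs_of_nonneg hnn]
    have hpow : 0 ≤ (1 - u) ^ p := rpow_nonneg hnn p
    rcases lt_or_ge (1 - u) δ with hlt | hge
    · have : ‖W u‖ ≤ c * ‖|u - 1| ^ p‖ := hball ⟨by rwa [Metric.mem_ball, dist_eq, habs], hu⟩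
      rw [habs, norm_of_nonneg hpow] at this
      exact ((le_abs_self _).trans this).trans
        (mul_le_mul_of_nonneg_right (le_max_left _ _) hpow)
    · calc W u ≤ M := (le_abs_self _).trans (hM u hu)
        _ = M / δ ^ p * δ ^ p := by field_simp
        _ ≤ M / δ ^ p * (1 - u) ^ p := by gcongr
        _ ≤ _ := mul_le_mul_of_nonneg_right (le_max_right _ _) hpow

/-- Consequences of (W1) and (W2): both wells are critical zeros of order `p`, and
the potential is positive between them. -/
theorem potential_properties {p : ℝ} {W : ℝ → ℝ} {Cm1 C0 C1 W0 : ℝ} (hp : 1 < p)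
    (hW : ContDiff ℝ 1 W) (hW1 : W1cond p W Cm1 C0 C1 W0) (hW2 : W2cond p W) :
    (W 1 = 0 ∧ deriv W 1 = 0) ∧ (W (-1) = 0 ∧ deriv W (-1) = 0) ∧
      (∀ u ∈ Ioo (-1 : ℝ) 1, 0 < W u) ∧
      ∃ K, 0 < K ∧ ∀ u ∈ Icc (-1 : ℝ) 1, W u ≤ K * (1 - u) ^ p ∧ W u ≤ K * (1 + u) ^ p := by
  obtain ⟨-, -, -, -, hasymp₁, hasymp₂, -⟩ := hW1
  obtain ⟨h₁, h₁', hpos₁, K₁, hK₁⟩ := potential_right_well hp hW hasymp₁ hW2.2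
  have hderiv : ∀ u, deriv (fun s => W (-s)) u = -deriv W (-u) := fun u => deriv_comp_neg W u
  obtain ⟨h₂, h₂', hpos₂, K₂, hK₂⟩ := potential_right_well (C := Cm1 / p) (W := fun s => W (-s)) hp
    (hW.comp contDiff_neg) (by
      have hlim : Tendsto (fun u : ℝ => -u) (𝓝[Icc (-1 : ℝ) 1] 1) (𝓝[Icc (-1 : ℝ) 1] (-1)) := by
        refine tendsto_nhdsWithin_iff.2
          ⟨(continuous_neg.tendsto 1).mono_left nhdsWithin_le_nhds, ?_⟩
        filter_upwards [self_mem_nhdsWithin] with u hu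
        exact ⟨by linarith [hu.2], by linarith [hu.1]⟩
      have habs : ∀ u : ℝ, |-u + 1| = |u - 1| := fun u => by rw [← abs_neg]; congr 1; ring
      simpa only [Function.comp_def, habs] using hasymp₂.comp_tendsto hlim) (by
      intro x hx y hy hxy
      have := hW2.1 (show -y ∈ Ico (-1 : ℝ) 0 from ⟨by linarith [hy.2], by linarith [hy.1]⟩)
        (show -x ∈ Ico (-1 : ℝ) 0 from ⟨by linarith [hx.2], by linarith [hx.1]⟩) (neg_lt_neg hxy)
      simpa [hderiv, phip, div_neg, neg_div] using this)
  rw [hderiv, neg_eq_zero] at h₂'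
  refine ⟨⟨h₁, h₁'⟩, ⟨h₂, h₂'⟩, fun u hu => ?_, max (max K₁ K₂) 1, by positivity,
    fun u hu => ⟨?_, ?_⟩⟩
  · rcases le_total 0 u with h | h
    · exact hpos₁ u ⟨h, hu.2⟩
    · simpa using hpos₂ (-u) ⟨by linarith, by linarith [hu.1]⟩
  · exact (hK₁ u hu).trans (mul_le_mul_of_nonneg_right
      ((le_max_left _ _).trans (le_max_left _ _)) (rpow_nonneg (by linarith [hu.2]) p))
  · have := hK₂ (-u) ⟨by linarith [hu.2], by linarith [hu.1]⟩
    simp only [neg_neg, sub_neg_eq_add] at this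
    exact this.trans (mul_le_mul_of_nonneg_right
      ((le_max_right _ _).trans (le_max_left _ _)) (rpow_nonneg (by linarith [hu.1]) p))

/-- At a critical zero of the potential the constant solution is global, with zero kinetic
energy. -/
theorem constant_zero_energy_solution {p a c : ℝ} {W : ℝ → ℝ} (hp : 1 < p) (hc : W c = 0)
    (hc' : deriv W c = 0) :
    IsSolAuto p a W (fun _ => c) (fun _ => 0) ∧
      (∀ _ : ℝ, -(1 / a) * Lfun p 0 + W c = 0) ∧ Integrable (fun _ : ℝ => Lfun p 0) := by
  have hL : Lfun p 0 = 0 := by simp [Lfun, zero_rpow (by linarith : p ≠ 0)]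
  refine ⟨⟨continuous_const, fun x => hasDerivAt_const x c, fun _ => 0, continuous_const,
    fun x => hasDerivAt_const x _, fun x => by simp [hc']⟩, fun _ => by simp [hL, hc], ?_⟩
  simp [hL]

/-- A trajectory with `w' = σ (a p* W(w))^{1/p}`, `σ = ±1`, inside `(-1, 1)` is a zero-energy
solution with integrable kinetic energy. -/
theorem zero_energy_solution_of_first_order {p a σ : ℝ} {W w : ℝ → ℝ} (hp : 1 < p) (ha : 0 < a)
    (hσ : σ = 1 ∨ σ = -1) (hW : ContDiff ℝ 1 W) (hpos : ∀ x, 0 < W (w x))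
    (hmem : ∀ x, w x ∈ Ioo (-1 : ℝ) 1)
    (hw : ∀ x, HasDerivAt w (σ * (a * (p / (p - 1)) * W (w x)) ^ (1 / p)) x) :
    IsSolAuto p a W w (fun x => σ * (a * (p / (p - 1)) * W (w x)) ^ (1 / p)) ∧
      (∀ x, -(1 / a) * Lfun p (σ * (a * (p / (p - 1)) * W (w x)) ^ (1 / p)) + W (w x) = 0) ∧
      Integrable (fun x => Lfun p (σ * (a * (p / (p - 1)) * W (w x)) ^ (1 / p))) := by
  have hp0 : 0 < p := by linarith
  have hp1 : 0 < p - 1 := sub_pos.2 hp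
  have hq : 0 < a * (p / (p - 1)) := by positivity
  have hσabs : |σ| = 1 := by rcases hσ with rfl | rfl <;> simp
  have hσσ : σ * σ = 1 := by rcases hσ with rfl | rfl <;> norm_num
  have hwc : Continuous w := continuous_iff_continuousAt.2 fun x => (hw x).continuousAt
  have hWwc : Continuous fun x => W (w x) := hW.continuous.comp hwc
  have hbase : ∀ x, 0 < a * (p / (p - 1)) * W (w x) := fun x => mul_pos hq (hpos x)
  have hFc : Continuous fun x => (a * (p / (p - 1)) * W (w x)) ^ (1 / p) :=
    (continuous_const.mul hWwc).rpow_const fun x => Or.inl (hbase x).ne'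
  have hL : ∀ x, Lfun p (σ * (a * (p / (p - 1)) * W (w x)) ^ (1 / p)) = a * W (w x) := fun x => by
    rw [Lfun, abs_mul, hσabs, one_mul, abs_of_pos (rpow_pos_of_pos (hbase x) _),
      ← rpow_mul (hbase x).le, one_div_mul_cancel hp0.ne', rpow_one]
    field_simp
  have hphi : ∀ x, phip p (σ * (a * (p / (p - 1)) * W (w x)) ^ (1 / p)) =
      σ * (a * (p / (p - 1)) * W (w x)) ^ ((p - 1) / p) := fun x => by
    have hF := rpow_pos_of_pos (hbase x) (1 / p)
    rw [phip, abs_mul, hσabs, one_mul, abs_of_pos hF, mul_left_comm, ← rpow_add_one hF.ne',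
      ← rpow_mul (hbase x).le]
    congr 2
    field_simp
    ring
  refine ⟨⟨continuous_const.mul hFc, hw, fun x => a * deriv W (w x),
    continuous_const.mul ((hW.continuous_deriv le_rfl).comp hwc), fun x => ?_, fun x => rfl⟩,
    fun x => ?_, ?_⟩
  · simp only [hphi]
    have hWd : HasDerivAt (fun y => W (w y)) _ x :=
      (hW.differentiable one_ne_zero (w x)).hasDerivAt.comp x (hw x)
    have := (((hWd.const_mul (a * (p / (p - 1)))).rpow_const (p := (p - 1) / p)
      (Or.inl (hbase x).ne')).const_mul σ)
    refine this.congr_deriv ?_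
    have hexp : (p - 1) / p - 1 = -(1 / p) := by field_simp; ring
    have hF := rpow_pos_of_pos (hbase x) (1 / p)
    rw [hexp, rpow_neg (hbase x).le]
    generalize (a * (p / (p - 1)) * W (w x)) ^ (1 / p) = F at hF
    field_simp
    linear_combination deriv W (w x) * hσσ
  · rw [hL]
    field_simp
    ring
  · simp only [hL]
    have hFint : Integrable fun x => (a * (p / (p - 1)) * W (w x)) ^ (1 / p) := by
      have hnn : ∀ x, 0 ≤ (a * (p / (p - 1)) * W (w x)) ^ (1 / p) :=
        fun x => rpow_nonneg (hbase x).le _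
      have hbd : ∀ x, |σ * w x| ≤ 1 := fun x => by
        rw [abs_mul, hσabs, one_mul]
        exact abs_le.2 ⟨(hmem x).1.le, (hmem x).2.le⟩
      refine integrable_of_hasDerivAt_of_nonneg_of_bounded (f := fun x => σ * w x)
        (fun x => ?_) hFc hnn (fun x => (abs_le.1 (hbd x)).1) (fun x => (abs_le.1 (hbd x)).2)
      simpa [← mul_assoc, hσσ] using (hw x).const_mul σ
    obtain ⟨M, hM⟩ := isCompact_Icc.exists_bound_of_continuousOn (s := Icc (-1 : ℝ) 1)
      (f := fun u => (a * (p / (p - 1)) * W u) ^ ((p - 1) / p) / (p / (p - 1)))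
      (((continuous_const.mul hW.continuous).rpow_const fun _ =>
        Or.inr (by positivity)).div_const _).continuousOn
    refine (hFint.const_mul M).mono' (continuous_const.mul hWwc).aestronglyMeasurable
      (Eventually.of_forall fun x => ?_)
    have hsplit : a * W (w x) = (a * (p / (p - 1)) * W (w x)) ^ ((p - 1) / p) / (p / (p - 1)) *
        (a * (p / (p - 1)) * W (w x)) ^ (1 / p) := by
      rw [div_mul_eq_mul_div, ← rpow_add (hbase x), ← add_div, sub_add_cancel, div_self hp0.ne',
        rpow_one]
      field_simp
    rw [hsplit, norm_mul, norm_of_nonneg (rpow_nonneg (hbase x).le (1 / p))]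
    exact mul_le_mul_of_nonneg_right (hM _ ⟨(hmem x).1.le, (hmem x).2.le⟩)
      (rpow_nonneg (hbase x).le _)

/-- A zero-energy solution of the autonomous equation
`-(φ_p(v'))' + a W'(v) = 0` extends to a solution defined on all of `ℝ`, still with zero
energy, whose kinetic energy `L(v')` is integrable over `ℝ`. -/
theorem zero_energy_solution_global_and_integrable
    (p a : ℝ) (hp : 1 < p) (ha : 0 < a)
    (W : ℝ → ℝ) (hW : ContDiff ℝ 1 W)
    (Cm1 C0 C1 W0 : ℝ) (hW1 : W1cond p W Cm1 C0 C1 W0) (hW2 : W2cond p W)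
    (I : Set ℝ) (hIopen : IsOpen I) (hIconn : IsPreconnected I) (hIne : I.Nonempty)
    (v v' : ℝ → ℝ) (hsol : IsSolAutoOn p a W v v' I)
    (hrange : ∀ x ∈ I, v x ∈ Set.Icc (-1:ℝ) 1)
    (hzero : ∀ x ∈ I, -(1 / a) * Lfun p (v' x) + W (v x) = 0) :
    ∃ w w' : ℝ → ℝ, IsSolAuto p a W w w' ∧ Set.EqOn w v I ∧
      (∀ x, -(1 / a) * Lfun p (w' x) + W (w x) = 0) ∧
      MeasureTheory.Integrable (fun x => Lfun p (w' x)) := by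
  have hp0 : 0 < p := by linarith
  have hp1 : 0 < p - 1 := sub_pos.2 hp
  have hq : 0 < a * (p / (p - 1)) := by positivity
  obtain ⟨⟨hone, hone'⟩, ⟨hneg, hneg'⟩, hpos, K, hK, hWle⟩ := potential_properties hp hW hW1 hW2
  obtain ⟨hv'c, hv, -⟩ := hsol
  have hWnn : ∀ u ∈ Icc (-1 : ℝ) 1, 0 ≤ W u := fun u hu => by
    rcases eq_or_lt_of_le hu.1 with rfl | h
    · exact hneg.ge
    rcases eq_or_lt_of_le hu.2 with rfl | h'
    · exact hone.ge
    exact (hpos u ⟨h, h'⟩).le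
  set F : ℝ → ℝ := fun u => (a * (p / (p - 1)) * W u) ^ (1 / p) with hFdef
  have hFc : Continuous F :=
    (continuous_const.mul hW.continuous).rpow_const fun _ => Or.inr (by positivity)
  have hFpos : ∀ u ∈ Ioo (-1 : ℝ) 1, 0 < F u := fun u hu =>
    rpow_pos_of_pos (mul_pos hq (hpos u hu)) _
  have habs : ∀ x ∈ I, |v' x| = F (v x) := fun x hx => by
    have h : |v' x| ^ p = a * (p / (p - 1)) * W (v x) := by
      have := hzero x hx
      rw [Lfun] at this
      field_simp at this ⊢
      linarith
    rw [hFdef]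
    simp only
    rw [← h, one_div, rpow_rpow_inv (abs_nonneg _) hp0.ne']
  set k : ℝ := (a * (p / (p - 1)) * K) ^ (1 / p)
  have hk : 0 < k := rpow_pos_of_pos (by positivity) _
  have hFle : ∀ u ∈ Icc (-1 : ℝ) 1, ∀ d, 0 ≤ d → W u ≤ K * d ^ p → F u ≤ k * d := by
    intro u hu d hd h
    calc F u ≤ (a * (p / (p - 1)) * K * d ^ p) ^ (1 / p) := by
          refine rpow_le_rpow (mul_nonneg hq.le (hWnn u hu)) ?_ (by positivity)
          rw [mul_assoc _ K]
          exact mul_le_mul_of_nonneg_left h hq.le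
      _ = k * d := by
          rw [mul_rpow (by positivity) (by positivity), one_div, rpow_rpow_inv hd hp0.ne', ← one_div]
  have hFle₁ : ∀ u ∈ Icc (-1 : ℝ) 1, F u ≤ k * (1 - u) := fun u hu =>
    hFle u hu _ (by linarith [hu.2]) (hWle u hu).1
  have hFle₂ : ∀ u ∈ Icc (-1 : ℝ) 1, F u ≤ k * (1 + u) := fun u hu =>
    hFle u hu _ (by linarith [hu.1]) (hWle u hu).2
  by_cases h1 : ∃ x₀ ∈ I, v x₀ = 1
  · obtain ⟨x₀, hx₀, hvx₀⟩ := h1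
    have hconst := eqOn_zero_of_abs_deriv_le hIconn (f := fun x => v x - 1) (K := k)
      (fun x hx => (hv x hx).sub_const 1) (fun x hx => by
        rw [habs x hx, abs_sub_comm, abs_of_nonneg (sub_nonneg.2 (hrange x hx).2)]
        exact hFle₁ _ (hrange x hx)) hx₀ (sub_eq_zero.2 hvx₀)
    obtain ⟨hs, he, hi⟩ := constant_zero_energy_solution (a := a) hp hone hone'
    exact ⟨fun _ => 1, fun _ => 0, hs, fun x hx => (sub_eq_zero.1 (hconst x hx)).symm, he, hi⟩
  by_cases h2 : ∃ x₀ ∈ I, v x₀ = -1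
  · obtain ⟨x₀, hx₀, hvx₀⟩ := h2
    have hconst := eqOn_zero_of_abs_deriv_le hIconn (f := fun x => v x + 1) (K := k)
      (fun x hx => (hv x hx).add_const 1) (fun x hx => by
        rw [habs x hx, abs_of_nonneg (by linarith [(hrange x hx).1]), add_comm]
        exact hFle₂ _ (hrange x hx)) hx₀ (by simp [hvx₀])
    obtain ⟨hs, he, hi⟩ := constant_zero_energy_solution (a := a) hp hneg hneg'
    exact ⟨fun _ => -1, fun _ => 0, hs,
      fun x hx => (eq_neg_of_add_eq_zero_left (hconst x hx)).symm, he, hi⟩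
  push Not at h1 h2
  have hmem : ∀ x ∈ I, v x ∈ Ioo (-1 : ℝ) 1 := fun x hx =>
    ⟨lt_of_le_of_ne (hrange x hx).1 (h2 x hx).symm, lt_of_le_of_ne (hrange x hx).2 (h1 x hx)⟩
  have hvc : ContinuousOn v I := fun x hx => (hv x hx).continuousAt.continuousWithinAt
  obtain ⟨σ, hσ, hσv⟩ : ∃ σ : ℝ, (σ = 1 ∨ σ = -1) ∧ ∀ x ∈ I, v' x = σ * F (v x) := by
    rcases hIconn.eq_or_eq_neg_of_sq_eq hv'c (hFc.comp_continuousOn hvc)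
      (fun x hx => by
        change v' x ^ 2 = F (v x) ^ 2
        rw [← habs x hx, sq_abs]) (fun {x} hx => (hFpos _ (hmem x hx)).ne') with h | h
    · exact ⟨1, Or.inl rfl, fun x hx => by simpa using h hx⟩
    · exact ⟨-1, Or.inr rfl, fun x hx => by simpa using h hx⟩
  obtain ⟨G, U, hG, hUmem, hU, hUG⟩ := exists_time_map_and_inverse hk hFc.continuousOn hFpos
    (fun u hu => hFle₁ u (Ioo_subset_Icc_self hu)) (fun u hu => hFle₂ u (Ioo_subset_Icc_self hu))
  obtain ⟨c, hc⟩ : ∃ c, ∀ x ∈ I, G (v x) - σ * x = c := by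
    have hd : ∀ x ∈ I, HasDerivAt (fun x => G (v x) - σ * x) 0 x := fun x hx => by
      have := ((hG _ (hmem x hx)).comp x (hv x hx)).sub ((hasDerivAt_id x).const_mul σ)
      refine this.congr_deriv ?_
      rw [hσv x hx]
      have := (hFpos _ (hmem x hx)).ne'
      field_simp
      ring
    exact hIopen.exists_is_const_of_deriv_eq_zero hIconn
      (fun x hx => (hd x hx).differentiableAt.differentiableWithinAt) fun x hx => (hd x hx).deriv
  obtain ⟨hs, he, hi⟩ := zero_energy_solution_of_first_order (w := fun x => U (σ * x + c)) hp ha hσ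
    hW (fun x => hpos _ (hUmem _)) (fun x => hUmem _) (fun x => by
      have := (hU (σ * x + c)).comp x (((hasDerivAt_id x).const_mul σ).add_const c)
      rw [mul_one, mul_comm] at this
      exact this)
  refine ⟨_, _, hs, fun x hx => ?_, he, hi⟩
  have : σ * x + c = G (v x) := by linarith [hc x hx]
  simp only [this, hUG _ (hmem x hx)]
end
end

section
/- Let p>1 and set γ_p=1/(p-1) if 1<p<2 and γ_p=1 if p≥2. For every v∈C^1([0,1]) such that v'(0)=v'(1)=0 and φ_p(v')∈C^1([0,1]), one has ‖φ_p(v')‖_∞^{p/(p-1)} ≤ 4 γ_p ‖v‖_∞ ‖(φ_p(v'))'‖_∞, where ‖·‖_∞ denotes the supremum norm on [0,1]. -/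
open Real Set Filter Topology MeasureTheory intervalIntegral Asymptotics

noncomputable section

/-- supremum norm on `[0,1]` -/
def sup01 (f : ℝ → ℝ) : ℝ := sSup ((fun x => |f x|) '' Set.Icc (0:ℝ) 1)

theorem phip_neg (p s : ℝ) : phip p (-s) = -phip p s := by
  simp [phip]

theorem phip_of_pos {p s : ℝ} (hs : 0 < s) : phip p s = s ^ (p - 1) := by
  rw [phip, abs_of_pos hs, ← rpow_add_one hs.ne']
  ring_nf

theorem abs_le_sup01 {f : ℝ → ℝ} (hf : ContinuousOn f (Icc 0 1)) {x : ℝ} (hx : x ∈ Icc (0 : ℝ) 1) :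
    |f x| ≤ sup01 f :=
  le_csSup (isCompact_Icc.image_of_continuousOn hf.abs).bddAbove (mem_image_of_mem _ hx)

theorem exists_abs_eq_sup01 {f : ℝ → ℝ} (hf : ContinuousOn f (Icc 0 1)) :
    ∃ x ∈ Icc (0 : ℝ) 1, |f x| = sup01 f :=
  (isCompact_Icc.image_of_continuousOn hf.abs).sSup_mem ((nonempty_Icc.2 zero_le_one).image _)

/-- A point where `f` is positive is preceded by a zero after which `f` stays positive, provided
that `f` vanishes at the left end of the interval. -/
theorem exists_zero_forall_pos {f : ℝ → ℝ} {a b : ℝ} (hab : a ≤ b)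
    (hf : ContinuousOn f (Icc a b)) (ha : f a = 0) (hb : 0 < f b) :
    ∃ c ∈ Icc a b, f c = 0 ∧ ∀ x ∈ Ioc c b, 0 < f x := by
  have hK : IsCompact (Icc a b ∩ f ⁻¹' {0}) :=
    isCompact_Icc.of_isClosed_subset (hf.preimage_isClosed_of_isClosed isClosed_Icc
      isClosed_singleton) inter_subset_left
  obtain ⟨c, ⟨hc, hc0⟩, hmax⟩ := hK.exists_isGreatest ⟨a, left_mem_Icc.2 hab, ha⟩
  refine ⟨c, hc, hc0, fun x hx => ?_⟩
  by_contra! hneg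
  have hsub : Icc x b ⊆ Icc a b := Icc_subset_Icc_left (hc.1.trans hx.1.le)
  obtain ⟨y, hy, hy0⟩ := intermediate_value_Icc hx.2 (hf.mono hsub) ⟨hneg, hb.le⟩
  exact (hx.1.trans_le hy.1).not_ge (hmax ⟨hsub hy, hy0⟩)

/-- The energy estimate at a point where `v'` is positive. -/
theorem phip_rpow_le_of_pos {p : ℝ} (hp : 1 < p) {v v' g : ℝ → ℝ} {V G : ℝ}
    (hv : ∀ x ∈ Icc (0 : ℝ) 1, HasDerivWithinAt v (v' x) (Icc 0 1) x)
    (hv'c : ContinuousOn v' (Icc 0 1)) (hb0 : v' 0 = 0)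
    (hg : ∀ x ∈ Icc (0 : ℝ) 1, HasDerivWithinAt (fun y => phip p (v' y)) (g x) (Icc 0 1) x)
    (hV : ∀ x ∈ Icc (0 : ℝ) 1, |v x| ≤ V) (hG : ∀ x ∈ Icc (0 : ℝ) 1, |g x| ≤ G)
    {b : ℝ} (hb : b ∈ Icc (0 : ℝ) 1) (hpos : 0 < v' b) :
    phip p (v' b) ^ (p / (p - 1)) ≤ 2 * (p / (p - 1)) * V * G := by
  have hp1 : 0 < p - 1 := sub_pos.2 hp
  set q := p / (p - 1) with hq
  have hq1 : 1 ≤ q := by rw [hq, one_le_div hp1]; linarith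
  have hpq : (p - 1) * (q - 1) = 1 := by rw [hq]; field_simp; ring
  have hG0 : 0 ≤ G := (abs_nonneg _).trans (hG b hb)
  obtain ⟨a, ha, ha0, hab⟩ := exists_zero_forall_pos hb.1
    (hv'c.mono (Icc_subset_Icc_right hb.2)) hb0 hpos
  have hsub : Icc a b ⊆ Icc 0 1 := Icc_subset_Icc ha.1 hb.2
  have hanti : AntitoneOn (fun x => phip p (v' x) ^ q - q * G * v x) (Icc a b) := by
    refine antitoneOn_of_hasDerivWithinAt_nonpos (convex_Icc a b)
      (f' := fun x => g x * q * phip p (v' x) ^ (q - 1) - q * G * v' x) ?_ ?_ ?_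
    · refine ContinuousOn.sub (ContinuousOn.rpow_const ?_ fun _ _ => Or.inr (by linarith))
        (ContinuousOn.mul continuousOn_const ?_)
      · exact fun x hx => ((hg x (hsub hx)).continuousWithinAt).mono hsub
      · exact fun x hx => ((hv x (hsub hx)).continuousWithinAt).mono hsub
    · intro x hx
      have hx' := interior_subset hx
      exact (((hg x (hsub hx')).mono (interior_subset.trans hsub)).rpow_const (Or.inr hq1)).sub
        (((hv x (hsub hx')).mono (interior_subset.trans hsub)).const_mul _)
    · intro x hx
      have hx' := interior_subset hx
      rw [interior_Icc] at hx
      have hx0 := hab x ⟨hx.1, hx.2.le⟩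
      have hgG := (le_abs_self _).trans (hG x (hsub hx'))
      have hinv : phip p (v' x) ^ (q - 1) = v' x := by
        rw [phip_of_pos hx0, ← rpow_mul hx0.le, hpq, rpow_one]
      rw [hinv]
      nlinarith [mul_le_mul_of_nonneg_right hgG (mul_nonneg (zero_le_one.trans hq1) hx0.le)]
  have key := hanti (left_mem_Icc.2 ha.2) (right_mem_Icc.2 ha.2) ha.2
  have hzero : phip p (v' a) ^ q = 0 := by
    rw [ha0, phip, mul_zero, zero_rpow (by linarith)]
  simp only [hzero] at key
  have hdiff : v b - v a ≤ 2 * V := by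
    linarith [le_of_abs_le (hV b hb), neg_le_of_abs_le (hV a (hsub (left_mem_Icc.2 ha.2)))]
  nlinarith [mul_le_mul_of_nonneg_left hdiff (mul_nonneg (zero_le_one.trans hq1) hG0)]

/-- Landau–Kolmogorov type inequality for the `φ_p`-operator:
`‖φ_p(v')‖_∞^{p/(p-1)} ≤ 4 γ_p ‖v‖_∞ ‖(φ_p(v'))'‖_∞` for `v ∈ C¹([0,1])` with
`v'(0) = v'(1) = 0` and `φ_p(v') ∈ C¹([0,1])`. -/
theorem landau_kolmogorov_phip
    (p : ℝ) (hp : 1 < p) (γ : ℝ) (hγ : γ = if p < 2 then 1 / (p - 1) else 1)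
    (v v' g : ℝ → ℝ)
    (hv : ∀ x ∈ Set.Icc (0:ℝ) 1, HasDerivWithinAt v (v' x) (Set.Icc 0 1) x)
    (hv'c : ContinuousOn v' (Set.Icc 0 1))
    (hb0 : v' 0 = 0) (hb1 : v' 1 = 0)
    (hg : ∀ x ∈ Set.Icc (0:ℝ) 1,
      HasDerivWithinAt (fun y => phip p (v' y)) (g x) (Set.Icc 0 1) x)
    (hgc : ContinuousOn g (Set.Icc 0 1)) :
    sup01 (fun x => phip p (v' x)) ^ (p / (p - 1)) ≤ 4 * γ * sup01 v * sup01 g := by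
  have hp1 : 0 < p - 1 := sub_pos.2 hp
  have hq : 2 * (p / (p - 1)) ≤ 4 * γ := by
    rw [hγ]
    split_ifs with h
    · rw [mul_div_assoc', mul_div_assoc', div_le_div_iff_of_pos_right hp1]; linarith
    · rw [mul_div_assoc', div_le_iff₀ hp1]; linarith
  have hvc : ContinuousOn v (Icc 0 1) := fun x hx => (hv x hx).continuousWithinAt
  have hV := fun x (hx : x ∈ Icc (0 : ℝ) 1) => abs_le_sup01 hvc hx
  have hG := fun x (hx : x ∈ Icc (0 : ℝ) 1) => abs_le_sup01 hgc hx
  have h0 : (0 : ℝ) ∈ Icc (0 : ℝ) 1 := left_mem_Icc.2 zero_le_one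
  have hV0 := (abs_nonneg _).trans (hV 0 h0)
  have hG0 := (abs_nonneg _).trans (hG 0 h0)
  obtain ⟨b, hb, hmax⟩ := exists_abs_eq_sup01 (f := fun x => phip p (v' x))
    fun x hx => (hg x hx).continuousWithinAt
  have hnonneg : 0 ≤ 2 * (p / (p - 1)) * sup01 v * sup01 g := by positivity
  suffices h : |phip p (v' b)| ^ (p / (p - 1)) ≤ 2 * (p / (p - 1)) * sup01 v * sup01 g by
    rw [← hmax]
    refine h.trans ?_
    gcongr
  rcases lt_trichotomy (v' b) 0 with hneg | hzero | hpos
  · have hpos : 0 < -v' b := neg_pos.2 hneg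
    have habs : |phip p (v' b)| = phip p (-v' b) := by
      rw [← abs_neg, ← phip_neg, phip_of_pos hpos, abs_of_nonneg (by positivity)]
    rw [habs]
    refine phip_rpow_le_of_pos hp (v := fun x => -v x) (v' := fun x => -v' x)
      (g := fun x => -g x) (fun x hx => (hv x hx).fun_neg) hv'c.fun_neg (by simp [hb0]) ?_
      (by simpa using hV) (by simpa using hG) hb hpos
    simpa only [phip_neg] using fun x hx => (hg x hx).fun_neg
  · rwa [hzero, phip, mul_zero, abs_zero, zero_rpow (by positivity)]
  · have habs : |phip p (v' b)| = phip p (v' b) := by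
      rw [phip_of_pos hpos, abs_of_nonneg (by positivity)]
    rw [habs]
    exact phip_rpow_le_of_pos hp hv hv'c hb0 hg hV hG hb hpos
end
end

section
/- Let p>1, let a∈C^1([0,1]) with a(x)>0 on [0,1], let W satisfy (W1) and (W2), and let {u_ε}_{ε>0} be a family of solutions of the Neumann problem (P_ε). Then: (a) for every ε>0 the energy E_ε satisfies E_ε'(x) = (a'(x)/a(x)^2) L(ε u_ε'(x)) for all x∈[0,1]; (b) there exists M>0 such that ‖φ_p(ε u_ε')‖_∞ ≤ M for all ε>0, so that {E_ε} is bounded in W^{1,∞}(0,1); consequently, every sequence ε_n→0^+ admits a subsequence along which E_{ε_n} converges uniformly on [0,1] to a Lipschitz function E. -/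
open Real Set Filter Topology MeasureTheory intervalIntegral Asymptotics

noncomputable section

lemma one_lt_div_sub_one {p : ℝ} (hp : 1 < p) : 1 < p / (p - 1) := by
  rw [one_lt_div (by linarith)]
  linarith

lemma abs_phip {p : ℝ} (hp : 1 < p) (s : ℝ) : |phip p s| = |s| ^ (p - 1) := by
  rcases eq_or_ne s 0 with rfl | hs
  · simp [phip, Real.zero_rpow (by linarith : p - 1 ≠ 0)]
  · rw [phip, abs_mul, abs_of_nonneg (Real.rpow_nonneg (abs_nonneg s) _),
      ← Real.rpow_add_one (abs_ne_zero.mpr hs)]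
    ring_nf

lemma Lfun_nonneg {p : ℝ} (hp : 1 < p) (s : ℝ) : 0 ≤ Lfun p s :=
  div_nonneg (Real.rpow_nonneg (abs_nonneg s) _) (by linarith [one_lt_div_sub_one hp])

/-- `L` as a function of `φ_p`. -/
lemma Lfun_eq_abs_phip_rpow {p : ℝ} (hp : 1 < p) (s : ℝ) :
    Lfun p s = |phip p s| ^ (p / (p - 1)) / (p / (p - 1)) := by
  have h : p - 1 ≠ 0 := by linarith
  rw [Lfun, abs_phip hp, ← Real.rpow_mul (abs_nonneg s), mul_div_cancel₀ _ h]

/-- `φ_{p*}` inverts `φ_p`. -/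
lemma phip_conj_phip {p : ℝ} (hp : 1 < p) (s : ℝ) : phip (p / (p - 1)) (phip p s) = s := by
  rcases eq_or_ne s 0 with rfl | hs
  · simp [phip]
  · have h : p - 1 ≠ 0 := by linarith
    have hexp : (p - 1) * (p / (p - 1) - 2) + (p - 2) = 0 := by
      field_simp
      ring
    rw [phip, abs_phip hp, ← Real.rpow_mul (abs_nonneg s), phip, ← mul_assoc,
      ← Real.rpow_add (abs_pos.mpr hs), hexp, Real.rpow_zero, one_mul]

lemma abs_phip_le_of_Lfun_le {p B s : ℝ} (hp : 1 < p) (h : Lfun p s ≤ B) :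
    |phip p s| ≤ 1 + p / (p - 1) * B := by
  have hq := one_lt_div_sub_one hp
  rw [Lfun_eq_abs_phip_rpow hp, div_le_iff₀' (by linarith)] at h
  have h0 : 0 ≤ |phip p s| ^ (p / (p - 1)) := Real.rpow_nonneg (abs_nonneg _) _
  rcases le_total |phip p s| 1 with h1 | h1
  · linarith
  · linarith [Real.self_le_rpow_of_one_le h1 hq.le]

lemma hasDerivWithinAt_Lfun {p s x g : ℝ} {w : ℝ → ℝ} {S : Set ℝ} (hp : 1 < p) (hs : w x = s)
    (hw : HasDerivWithinAt (fun y => phip p (w y)) g S x) :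
    HasDerivWithinAt (fun y => Lfun p (w y)) (s * g) S x := by
  subst hs
  have hq := one_lt_div_sub_one hp
  have h := ((hasDerivAt_abs_rpow (phip p (w x)) hq).comp_hasDerivWithinAt x hw).div_const
    (p / (p - 1))
  have hval := phip_conj_phip hp (w x)
  rw [phip] at hval
  simp only [Lfun_eq_abs_phip_rpow hp]
  refine h.congr_deriv ?_
  rw [div_eq_iff (by linarith)]
  linear_combination (p / (p - 1) * g) * hval

section Neumann

variable {p ε : ℝ} {a W u u' : ℝ → ℝ} {x : ℝ}

lemma IsSolOn.hasDerivWithinAt_Lfun {S : Set ℝ} (hp : 1 < p) (h : IsSolOn p ε a W u u' S)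
    (hx : x ∈ S) :
    HasDerivWithinAt (fun y => Lfun p (ε * u' y)) (a x * deriv W (u x) * u' x) S x := by
  obtain ⟨-, -, g, -, hg, heq⟩ := h
  have hL := _root_.hasDerivWithinAt_Lfun (w := fun y => ε * u' y) hp rfl (hg x hx)
  rw [← heq x hx]
  exact hL.congr_deriv (by ring)

lemma IsSolOn.hasDerivWithinAt_comp {S : Set ℝ} (hW : ContDiff ℝ 1 W)
    (h : IsSolOn p ε a W u u' S) (hx : x ∈ S) :
    HasDerivWithinAt (fun y => W (u y)) (deriv W (u x) * u' x) S x :=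
  ((hW.differentiable one_ne_zero).differentiableAt.hasDerivAt).comp_hasDerivWithinAt x
    (h.2.1 x hx)

lemma IsSolOn.hasDerivWithinAt_Ener {S : Set ℝ} (hp : 1 < p) (ha : ContDiff ℝ 1 a)
    (hW : ContDiff ℝ 1 W) (h : IsSolOn p ε a W u u' S) (hx : x ∈ S) (hax : a x ≠ 0) :
    HasDerivWithinAt (fun y => Ener p ε a W u u' y)
      (deriv a x / (a x) ^ 2 * Lfun p (ε * u' x)) S x := by
  have hda : HasDerivWithinAt a (deriv a x) S x :=
    (ha.differentiable one_ne_zero).differentiableAt.hasDerivAt.hasDerivWithinAt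
  have hE := ((hda.fun_inv hax).mul (h.hasDerivWithinAt_Lfun hp hx)).neg.add
    (h.hasDerivWithinAt_comp hW hx)
  simp only [Ener, one_div, neg_mul]
  refine hE.congr_deriv ?_
  field_simp
  ring

/-- The derivative of `a W(u) - L(εu') = a E_ε` does not involve `u'`. -/
lemma IsSolOn.hasDerivWithinAt_mul_sub_Lfun {S : Set ℝ} (hp : 1 < p) (ha : ContDiff ℝ 1 a)
    (hW : ContDiff ℝ 1 W) (h : IsSolOn p ε a W u u' S) (hx : x ∈ S) :
    HasDerivWithinAt (fun y => a y * W (u y) - Lfun p (ε * u' y)) (deriv a x * W (u x)) S x := by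
  have hda : HasDerivWithinAt a (deriv a x) S x :=
    (ha.differentiable one_ne_zero).differentiableAt.hasDerivAt.hasDerivWithinAt
  exact ((hda.mul (h.hasDerivWithinAt_comp hW hx)).sub
    (h.hasDerivWithinAt_Lfun hp hx)).congr_deriv (by ring)

lemma IsNeumann.Lfun_le {A D B : ℝ} (hp : 1 < p) (ha : ContDiff ℝ 1 a) (hW : ContDiff ℝ 1 W)
    (h : IsNeumann p ε a W u u') (hA : ∀ x ∈ Icc (0 : ℝ) 1, |a x| ≤ A)
    (hD : ∀ x ∈ Icc (0 : ℝ) 1, |deriv a x| ≤ D) (hB : ∀ x ∈ Icc (0 : ℝ) 1, |W (u x)| ≤ B)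
    (hx : x ∈ Icc (0 : ℝ) 1) : Lfun p (ε * u' x) ≤ 2 * (A * B) + D * B := by
  have h0 : (0 : ℝ) ∈ Icc (0 : ℝ) 1 := by simp
  have haW : ∀ y ∈ Icc (0 : ℝ) 1, |a y * W (u y)| ≤ A * B := fun y hy => by
    rw [abs_mul]
    exact mul_le_mul (hA y hy) (hB y hy) (abs_nonneg _) ((abs_nonneg _).trans (hA y hy))
  have hDB : ∀ y ∈ Icc (0 : ℝ) 1, ‖deriv a y * W (u y)‖ ≤ D * B := fun y hy => by
    rw [Real.norm_eq_abs, abs_mul]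
    exact mul_le_mul (hD y hy) (hB y hy) (abs_nonneg _) ((abs_nonneg _).trans (hD y hy))
  have hmv := (convex_Icc (0 : ℝ) 1).norm_image_sub_le_of_norm_hasDerivWithin_le
    (fun y hy => h.1.hasDerivWithinAt_mul_sub_Lfun hp ha hW hy) hDB h0 hx
  have hL0 : Lfun p (ε * u' 0) = 0 := by
    rw [h.2.1, Lfun, mul_zero, abs_zero, Real.zero_rpow (by linarith), zero_div]
  have hDB0 : 0 ≤ D * B := (norm_nonneg _).trans (hDB 0 h0)
  rw [hL0, Real.norm_eq_abs, Real.norm_eq_abs, sub_zero, sub_zero, abs_of_nonneg hx.1] at hmv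
  have hle : D * B * x ≤ D * B := mul_le_of_le_one_right hDB0 hx.2
  have h1 := (abs_le.mp hmv).1
  have h2 := (abs_le.mp (haW x hx)).2
  have h3 := (abs_le.mp (haW 0 h0)).1
  linarith

end Neumann

/-- A uniformly bounded, uniformly Lipschitz sequence on a compact set has a uniformly convergent
subsequence with Lipschitz limit. -/
lemma exists_subseq_tendstoUniformlyOn_of_lipschitzOnWith {S : Set ℝ} (hS : IsCompact S)
    {f : ℕ → ℝ → ℝ} {K : NNReal} {B : ℝ} (hK : ∀ n, LipschitzOnWith K (f n) S)
    (hB : ∀ n, ∀ x ∈ S, |f n x| ≤ B) :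
    ∃ φ : ℕ → ℕ, StrictMono φ ∧ ∃ E : ℝ → ℝ, LipschitzOnWith K E S ∧
      TendstoUniformlyOn (fun n x => f (φ n) x) E atTop S := by
  have : CompactSpace S := isCompact_iff_compactSpace.mp hS
  let A : Set (BoundedContinuousFunction S ℝ) :=
    {g | LipschitzWith K g ∧ ∀ x, g x ∈ Icc (-B) B}
  have hAclosed : IsClosed A := by
    simp only [A, lipschitzWith_iff_dist_le_mul, ofPred_and, ofPred_forall]
    refine IsClosed.inter (isClosed_iInter fun x => isClosed_iInter fun y => ?_)
      (isClosed_iInter fun x => isClosed_Icc.preimage (continuous_eval_const x))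
    exact isClosed_le ((continuous_eval_const x).dist (continuous_eval_const y)) continuous_const
  have hA : IsCompact A :=
    BoundedContinuousFunction.arzela_ascoli₂ (Icc (-B) B) isCompact_Icc A hAclosed
      (fun g x hg => hg.2 x)
      (LipschitzWith.uniformEquicontinuous _ K fun g => g.2.1).equicontinuous
  have hres : ∀ n, LipschitzWith K (fun x : S => f n x) := fun n =>
    lipschitzOnWith_iff_restrict.mp (hK n)
  let F : ℕ → BoundedContinuousFunction S ℝ := fun n =>
    BoundedContinuousFunction.mkOfCompact ⟨fun x : S => f n x, (hres n).continuous⟩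
  obtain ⟨G, hG, φ, hφ, hlim⟩ := hA.tendsto_subseq (x := F) fun n =>
    ⟨hres n, fun x => abs_le.mp (hB n x x.2)⟩
  classical
  let E : ℝ → ℝ := fun x => if hx : x ∈ S then G ⟨x, hx⟩ else 0
  have hE : ∀ x : S, E x = G x := fun x => by simp [E]
  refine ⟨φ, hφ, E, ?_, ?_⟩
  · rw [lipschitzOnWith_iff_restrict]
    exact (funext hE : S.domRestrict E = G) ▸ hG.1
  · rw [tendstoUniformlyOn_iff_tendstoUniformly_comp_coe]
    exact (funext hE : E ∘ (↑) = G) ▸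
      BoundedContinuousFunction.tendsto_iff_tendstoUniformly.mp hlim

/-- For a family `{u_ε}` of solutions of the Neumann problem `(P_ε)`:
(a) the energy `E_ε` satisfies `E_ε'(x) = (a'(x)/a(x)²) L(ε u_ε'(x))` on `[0,1]`;
(b) `‖φ_p(ε u_ε')‖_∞` is bounded uniformly in `ε`, so that `{E_ε}` is bounded in `W^{1,∞}`;
(c) every sequence `ε_n → 0⁺` has a subsequence along which the energies converge uniformly
on `[0,1]` to a Lipschitz function `E`. -/
theorem energy_identity_and_compactness
    (p : ℝ) (hp : 1 < p)
    (a : ℝ → ℝ) (haC : ContDiff ℝ 1 a) (hapos : ∀ x ∈ Set.Icc (0:ℝ) 1, 0 < a x)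
    (W : ℝ → ℝ) (hW : ContDiff ℝ 1 W)
    (Cm1 C0 C1 W0 : ℝ) (hW1 : W1cond p W Cm1 C0 C1 W0) (hW2 : W2cond p W)
    (u u' : ℝ → ℝ → ℝ)
    (hrange : ∀ ε > (0:ℝ), ∀ x ∈ Set.Icc (0:ℝ) 1, u ε x ∈ Set.Icc (-1:ℝ) 1)
    (hsol : ∀ ε > (0:ℝ), IsNeumann p ε a W (u ε) (u' ε)) :
    (∀ ε > (0:ℝ), ∀ x ∈ Set.Icc (0:ℝ) 1,
      HasDerivWithinAt (fun y => Ener p ε a W (u ε) (u' ε) y)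
        (deriv a x / (a x) ^ 2 * Lfun p (ε * u' ε x)) (Set.Icc 0 1) x) ∧
    (∃ M : ℝ, 0 < M ∧ ∀ ε > (0:ℝ), ∀ x ∈ Set.Icc (0:ℝ) 1, |phip p (ε * u' ε x)| ≤ M) ∧
    (∀ εn : ℕ → ℝ, (∀ n, 0 < εn n) → Tendsto εn atTop (𝓝 0) →
      ∃ φ : ℕ → ℕ, StrictMono φ ∧ ∃ (E : ℝ → ℝ) (Lc : NNReal),
        LipschitzOnWith Lc E (Set.Icc 0 1) ∧
        TendstoUniformlyOn
          (fun n x => Ener p (εn (φ n)) a W (u (εn (φ n))) (u' (εn (φ n))) x)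
          E atTop (Set.Icc 0 1)) := by
  have bdd : ∀ (c d : ℝ) {f : ℝ → ℝ}, Continuous f → ∃ B, ∀ x ∈ Icc c d, |f x| ≤ B :=
    fun c d f hf => isCompact_Icc.exists_bound_of_continuousOn hf.continuousOn
  obtain ⟨A, hA⟩ := bdd 0 1 haC.continuous
  obtain ⟨D, hD⟩ := bdd 0 1 (haC.continuous_deriv le_rfl)
  obtain ⟨B, hB⟩ := bdd (-1) 1 hW.continuous
  obtain ⟨I, hI⟩ : ∃ I, ∀ x ∈ Icc (0 : ℝ) 1, |(a x)⁻¹| ≤ I :=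
    isCompact_Icc.exists_bound_of_continuousOn
      (haC.continuous.continuousOn.inv₀ fun x hx => (hapos x hx).ne')
  set R : ℝ := 2 * (A * B) + D * B
  have hL : ∀ ε > (0 : ℝ), ∀ x ∈ Icc (0 : ℝ) 1, Lfun p (ε * u' ε x) ≤ R := fun ε hε x hx =>
    (hsol ε hε).Lfun_le hp haC hW hA hD (fun y hy => hB _ (hrange ε hε y hy)) hx
  have h0 : (0 : ℝ) ∈ Icc (0 : ℝ) 1 := by simp
  have hI0 : 0 ≤ I := (abs_nonneg _).trans (hI 0 h0)
  have hD0 : 0 ≤ D := (abs_nonneg _).trans (hD 0 h0)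
  have hR0 : 0 ≤ R := (Lfun_nonneg hp _).trans (hL 1 one_pos 0 h0)
  have hderiv : ∀ ε > (0 : ℝ), ∀ x ∈ Icc (0 : ℝ) 1,
      HasDerivWithinAt (fun y => Ener p ε a W (u ε) (u' ε) y)
        (deriv a x / (a x) ^ 2 * Lfun p (ε * u' ε x)) (Icc 0 1) x := fun ε hε x hx =>
    (hsol ε hε).1.hasDerivWithinAt_Ener hp haC hW hx (hapos x hx).ne'
  refine ⟨hderiv, ⟨1 + p / (p - 1) * R, ?_, fun ε hε x hx =>
    abs_phip_le_of_Lfun_le hp (hL ε hε x hx)⟩, fun εn hεn _ => ?_⟩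
  · have := one_lt_div_sub_one hp
    positivity
  have hK : ∀ n, LipschitzOnWith (D * I ^ 2 * R).toNNReal
      (fun x => Ener p (εn n) a W (u (εn n)) (u' (εn n)) x) (Icc 0 1) := fun n => by
    refine (convex_Icc (0 : ℝ) 1).lipschitzOnWith_of_nnnorm_hasDerivWithin_le
      (hderiv (εn n) (hεn n)) fun x hx => ?_
    rw [← NNReal.coe_le_coe, coe_nnnorm, Real.coe_toNNReal _ (by positivity), Real.norm_eq_abs,
      div_eq_mul_inv, ← inv_pow, abs_mul, abs_mul, abs_pow, abs_of_nonneg (Lfun_nonneg hp _)]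
    gcongr
    · exact Lfun_nonneg hp _
    · exact hD x hx
    · exact hI x hx
    · exact hL _ (hεn n) x hx
  have hbound : ∀ n, ∀ x ∈ Icc (0 : ℝ) 1,
      |Ener p (εn n) a W (u (εn n)) (u' (εn n)) x| ≤ I * R + B := fun n x hx => by
    refine (abs_add_le _ _).trans (add_le_add ?_ (hB _ (hrange _ (hεn n) x hx)))
    rw [abs_mul, abs_neg, one_div, abs_of_nonneg (Lfun_nonneg hp _)]
    exact mul_le_mul (hI x hx) (hL _ (hεn n) x hx) (Lfun_nonneg hp _) hI0
  obtain ⟨φ, hφ, E, hE, hlim⟩ :=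
    exists_subseq_tendstoUniformlyOn_of_lipschitzOnWith isCompact_Icc hK hbound
  exact ⟨φ, hφ, E, _, hE, hlim⟩
end
end
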